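/- Let V be a finite set and E a finite set of unordered pairs {u,v} of distinct elements of V. Let J : E → ℝ satisfy J_e ≥ 0 for all e ∈ E, and let λ : V → ℝ satisfy λ_v ≥ 0 for all v. Then for every family (z_v)_{v∈V} of complex numbers with Re z_v > 0 for all v ∈ V, one has ∫_{(−π,π]^V} exp( Σ_{{u,v}∈E} J_{{u,v}} cos(θ_u − θ_v) ) · exp( Σ_{v∈V} z_v λ_v cos θ_v ) ∏_{v∈V} dθ_v ≠ 0. -/

import Mathlib

open MeasureTheory Real

/-- For a configuration of angles `θ : V → ℝ`, the symmetric function sending an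
unordered pair `{u, v}` to `cos (θ u - θ v)`. -/
noncomputable def xyEdgeCos {V : Type*} (θ : V → ℝ) : Sym2 V → ℝ :=
  Sym2.lift ⟨fun u v => Real.cos (θ u - θ v), fun u v => by
    show Real.cos (θ u - θ v) = Real.cos (θ v - θ u); rw [← Real.cos_neg, neg_sub]⟩

open Filter Topology

/-- **Hurwitz's theorem**, in the form of a persistence of non-vanishing. -/
theorem ne_zero_of_tendstoLocallyUniformlyOn {U : Set ℂ} (hU : IsOpen U) (hUc : IsPreconnected U)
    {F : ℕ → ℂ → ℂ} {f : ℂ → ℂ} (hF : ∀ n, DifferentiableOn ℂ (F n) U)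
    (hne : ∀ᶠ n in atTop, ∀ z ∈ U, F n z ≠ 0)
    (hlim : TendstoLocallyUniformlyOn F f atTop U) {z₀ z : ℂ} (hz₀ : z₀ ∈ U) (hfz₀ : f z₀ ≠ 0)
    (hz : z ∈ U) : f z ≠ 0 := by
  intro hfz
  have hf : DifferentiableOn ℂ f U := hlim.differentiableOn (.of_forall hF) hU
  have hfa : AnalyticOnNhd ℂ f U := hf.analyticOnNhd hU
  rcases (hfa z hz).eventually_eq_zero_or_eventually_ne_zero with h0 | h0
  · exact hfz₀ (hfa.eqOn_zero_of_preconnected_of_eventuallyEq_zero hUc hz h0 hz₀)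
  rw [eventually_nhdsWithin_iff] at h0
  obtain ⟨r, hr, hball⟩ := Metric.nhds_basis_closedBall.mem_iff.1 (h0.and (hU.mem_nhds hz))
  have hsub : Metric.closedBall z r ⊆ U := fun w hw => (hball hw).2
  have hcont : ContinuousOn (fun w => ‖f w‖) (Metric.sphere z r) :=
    (hf.continuousOn.mono (Metric.sphere_subset_closedBall.trans hsub)).norm
  obtain ⟨w₀, hw₀, hmin⟩ := (isCompact_sphere z r).exists_isMinOn
    (NormedSpace.sphere_nonempty.2 hr.le) hcont
  have hδ : 0 < ‖f w₀‖ := by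
    refine norm_pos_iff.2 ((hball (Metric.sphere_subset_closedBall hw₀)).1 ?_)
    rintro rfl
    simp [hr.ne] at hw₀
  have hunif : TendstoUniformlyOn F f atTop (Metric.closedBall z r) :=
    (tendstoLocallyUniformlyOn_iff_forall_isCompact hU).1 hlim _ hsub (isCompact_closedBall z r)
  obtain ⟨n, hn, hne⟩ :=
    ((Metric.tendstoUniformlyOn_iff.1 hunif (‖f w₀‖ / 2) (by positivity)).and hne).exists
  have hsphere : ∀ w ∈ Metric.sphere z r, ‖(F n w)⁻¹‖ ≤ (‖f w₀‖ / 2)⁻¹ := by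
    intro w hw
    rw [norm_inv]
    refine inv_anti₀ (by positivity) ?_
    have h1 := hn w (Metric.sphere_subset_closedBall hw)
    have h2 : ‖f w₀‖ ≤ ‖f w‖ := hmin hw
    have h3 := norm_sub_norm_le (f w) (F n w)
    rw [dist_eq_norm] at h1
    linarith
  have hd : DiffContOnCl ℂ (fun w => (F n w)⁻¹) (Metric.ball z r) := by
    refine DifferentiableOn.diffContOnCl ?_
    rw [closure_ball z hr.ne']
    exact ((hF n).mono hsub).inv fun w hw => hne w (hsub hw)
  have hmax := Complex.norm_le_of_forall_mem_frontier_norm_le Metric.isBounded_ball hd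
    (by rwa [frontier_ball z hr.ne']) (subset_closure (Metric.mem_ball_self hr))
  have h1 := hn z (Metric.mem_closedBall_self hr.le)
  rw [hfz, dist_zero_left] at h1
  rw [norm_inv] at hmax
  have := inv_lt_inv₀ (by positivity) (norm_pos_iff.2 (hne z hz)) |>.2 h1
  linarith

theorem tendstoLocallyUniformlyOn_of_forall_tendsto_prod {U : Set ℂ} {F : ℕ → ℂ → ℂ} {f : ℂ → ℂ}
    (h : ∀ z ∈ U, Tendsto (fun p : ℕ × ℂ => F p.1 p.2) (atTop ×ˢ 𝓝 z) (𝓝 (f z))) :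
    TendstoLocallyUniformlyOn F f atTop U := by
  have hpt : ∀ z ∈ U, Tendsto (fun n => F n z) atTop (𝓝 (f z)) := fun z hz =>
    (h z hz).comp (tendsto_id.prodMk tendsto_const_pure |>.mono_right
      (prod_mono_right _ (pure_le_nhds z)))
  rw [Metric.tendstoLocallyUniformlyOn_iff]
  intro ε hε z hz
  have h1 := (h z hz).eventually (Metric.ball_mem_nhds (f z) (show 0 < ε / 3 by positivity))
  obtain ⟨p, hp, q, hq, hpq⟩ := eventually_prod_iff.1 h1
  refine ⟨{w | q w} ∩ U, inter_mem (mem_nhdsWithin_of_mem_nhds hq) self_mem_nhdsWithin, ?_⟩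
  filter_upwards [hp] with n hn w hw
  have h2 : dist (f w) (f z) ≤ ε / 3 := by
    refine le_of_tendsto ((hpt w hw.2).dist tendsto_const_nhds) ?_
    filter_upwards [hp] with m hm
    exact (hpq hm hw.1).le
  have h3 : dist (F n w) (f z) < ε / 3 := hpq hn hw.1
  have := dist_triangle_right (f w) (F n w) (f z)
  linarith

theorem tendsto_one_add_pow_exp {ι : Type*} {l : Filter ι} {N : ι → ℕ} {g : ι → ℂ} {t : ℂ}
    (hN : Tendsto N l atTop) (h : Tendsto (fun i => (N i : ℂ) * g i) l (𝓝 t)) :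
    Tendsto (fun i => (1 + g i) ^ N i) l (𝓝 (Complex.exp t)) := by
  have hinv : Tendsto (fun i => ((N i : ℂ))⁻¹) l (𝓝 0) :=
    (tendsto_inv_atTop_nhds_zero_nat (𝕜 := ℂ)).comp hN
  have hg : Tendsto g l (𝓝 0) := by
    have := hinv.mul h
    rw [zero_mul] at this
    refine this.congr' ?_
    filter_upwards [hN.eventually_ne_atTop 0] with i hi
    have : (N i : ℂ) ≠ 0 := by exact_mod_cast hi
    field_simp
  have hg1 : Tendsto (fun i => 1 + g i) l (𝓝 1) := by simpa using hg.const_add 1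
  have hlog : HasDerivAt Complex.log 1 1 := by
    simpa using Complex.hasDerivAt_log Complex.one_mem_slitPlane
  have hφ : Tendsto (dslope Complex.log 1) (𝓝 1) (𝓝 1) := by
    have := (continuousAt_dslope_same.2 hlog.differentiableAt).tendsto
    rwa [dslope_same, hlog.deriv] at this
  have hprod := h.mul (hφ.comp hg1)
  rw [mul_one] at hprod
  refine ((Complex.continuous_exp.tendsto t).comp hprod).congr' ?_
  filter_upwards [hg1.eventually_ne one_ne_zero] with i hi
  have key := sub_smul_dslope Complex.log 1 (1 + g i)
  simp only [add_sub_cancel_left, smul_eq_mul, Complex.log_one, sub_zero] at key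
  simp only [Function.comp_apply]
  rw [mul_assoc, key, Complex.exp_nat_mul, Complex.exp_log hi]

/-- Two-variable contraction for the closed right half-plane. -/
theorem add_mul_ne_zero_of_biaffine_ne_zero {a b c d : ℂ}
    (h : ∀ s t : ℂ, 0 ≤ s.re → 0 ≤ t.re → a + s * b + t * c + s * t * d ≠ 0) {κ : ℝ}
    (hκ : 0 ≤ κ) : a + κ * d ≠ 0 := by
  intro h0
  have ha : a ≠ 0 := by simpa using h 0 0 le_rfl le_rfl
  have hκ' : 0 < κ := by
    rcases hκ.eq_or_lt with rfl | h'
    · simp [ha] at h0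
    · exact h'
  have hκc : (κ : ℂ) ≠ 0 := by exact_mod_cast hκ'.ne'
  have hd : d = -a / κ := by
    rw [eq_div_iff hκc]; linear_combination h0
  have key : ∀ x : ℂ, (∀ s : ℂ, 0 ≤ s.re → 1 + s * x ≠ 0) → 0 ≤ x.re := by
    intro x hx
    by_contra hneg
    push Not at hneg
    have hx0 : x ≠ 0 := by rintro rfl; simp at hneg
    refine hx (-x⁻¹) ?_ (by field_simp; ring)
    rw [Complex.neg_re, Complex.inv_re]
    have := Complex.normSq_pos.2 hx0
    rw [← neg_div]
    exact div_nonneg (by linarith) this.le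
  have hb : 0 ≤ (b / a).re := key _ fun s hs h1 => h s 0 hs le_rfl <| by
    field_simp at h1
    linear_combination h1
  have hc : 0 ≤ (c / a).re ∧ ((c / a).re = 0 → c = 0) := by
    refine ⟨key _ fun s hs h1 => h 0 s le_rfl hs <| by
      field_simp at h1
      linear_combination h1, fun h1 => ?_⟩
    by_contra hc0
    refine h 0 (-(c / a)⁻¹) le_rfl ?_ ?_
    · simp only [Complex.neg_re, Complex.inv_re, h1]; simp
    · field_simp; ring
  set β := b / a with hβ
  set γ := c / a with hγ
  have hbβ : b = a * β := by rw [hβ]; field_simp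
  have hcγ : c = a * γ := by rw [hγ]; field_simp
  -- a positive step `r` for which `κ * γ + r * (1 + κ * β * γ)` stays in the half-plane
  obtain ⟨r, hr, hrre⟩ : ∃ r : ℝ, 0 < r ∧ 0 ≤ (κ * γ + r * (1 + κ * β * γ)).re := by
    rcases hc.1.eq_or_lt with h1 | h1
    · refine ⟨1, one_pos, ?_⟩
      have : γ = 0 := by rw [hγ, hc.2 h1.symm]; simp
      simp [this]
    · have hpos : 0 < κ * γ.re := by positivity
      refine ⟨κ * γ.re / (|(1 + κ * β * γ).re| + 1), by positivity, ?_⟩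
      rw [Complex.add_re, Complex.re_ofReal_mul, Complex.re_ofReal_mul]
      set q := (1 + κ * β * γ : ℂ).re
      have h2 : κ * γ.re / (|q| + 1) * (-q) ≤ κ * γ.re := by
        rw [div_mul_eq_mul_div, div_le_iff₀ (by positivity)]
        exact mul_le_mul_of_nonneg_left (by linarith [neg_abs_le q]) hpos.le
      linarith
  have hrc : (r : ℂ) ≠ 0 := by exact_mod_cast hr.ne'
  refine h (κ * γ + r * (1 + κ * β * γ)) (κ * (β + (r : ℂ)⁻¹)) hrre ?_ ?_
  · rw [Complex.re_ofReal_mul, Complex.add_re, ← Complex.ofReal_inv, Complex.ofReal_re]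
    positivity
  · rw [hd, hbβ, hcγ]
    field_simp
    ring

open Polynomial in
theorem eval_iterate_derivative_ne_zero {p : ℂ[X]} (hp : ∀ z : ℂ, 0 ≤ z.re → p.eval z ≠ 0) {k : ℕ}
    (hk : k ≤ p.natDegree) {z : ℂ} (hz : 0 ≤ z.re) : (derivative^[k] p).eval z ≠ 0 := by
  induction k generalizing z with
  | zero => exact hp z hz
  | succ k ih =>
    intro h0
    set q := derivative^[k] p with hq
    have hdeg : 0 < q.degree := by
      rw [← natDegree_pos_iff_degree_pos, hq]
      have hcoeff : (derivative^[k] p).coeff (p.natDegree - k) ≠ 0 := by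
        rw [coeff_iterate_derivative, Nat.sub_add_cancel (by omega), nsmul_eq_mul]
        refine mul_ne_zero ?_ ?_
        · exact_mod_cast (Nat.descFactorial_pos.2 (by omega)).ne'
        · rw [coeff_natDegree, leadingCoeff_ne_zero]
          rintro rfl
          exact hp 0 le_rfl (by simp)
      have := le_natDegree_of_ne_zero hcoeff
      omega
    have hq0 : q ≠ 0 := by rintro h; simp [h] at hdeg
    have hd0 : derivative q ≠ 0 := by
      intro h
      have := derivative_eq_zero.1 h
      rw [← natDegree_pos_iff_degree_pos] at hdeg
      omega
    rw [Function.iterate_succ_apply', ← hq] at h0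
    have hmem : z ∈ (derivative q).rootSet ℂ := by
      rw [mem_rootSet]; exact ⟨hd0, by simpa using h0⟩
    have hsub : q.rootSet ℂ ⊆ {w : ℂ | w.re < 0} := by
      intro w hw
      rw [mem_rootSet, coe_aeval_eq_eval] at hw
      by_contra hw'
      exact ih (by omega) (not_lt.1 hw') hw.2
    have := convexHull_min hsub (convex_halfSpace_re_lt 0)
      (rootSet_derivative_subset_convexHull_rootSet hdeg hmem)
    exact absurd this (not_lt.2 hz)

open Polynomial in
theorem coeff_ne_zero_of_eval_ne_zero {p : ℂ[X]} (hp : ∀ z : ℂ, 0 ≤ z.re → p.eval z ≠ 0) {k : ℕ}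
    (hk : k ≤ p.natDegree) : p.coeff k ≠ 0 := by
  have h := eval_iterate_derivative_ne_zero hp hk (z := 0) le_rfl
  rw [← coeff_zero_eq_eval_zero, coeff_iterate_derivative, zero_add, nsmul_eq_mul] at h
  exact right_ne_zero_of_mul h

theorem differentiable_integral_of_locally_bounded {α : Type*} [TopologicalSpace α]
    [MeasurableSpace α] [OpensMeasurableSpace α] {μ : Measure α} [IsFiniteMeasure μ]
    {F : α → ℂ → ℂ} (hcont : Continuous F.uncurry) (hd : ∀ x, Differentiable ℂ (F x))
    (hb : ∀ R : ℝ, ∃ C : ℝ, ∀ x z, ‖z‖ ≤ R → ‖F x z‖ ≤ C) :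
    Differentiable ℂ fun z => ∫ x, F x z ∂μ := by
  intro z₀
  obtain ⟨C, hC⟩ := hb (‖z₀‖ + 2)
  have hmeas : ∀ z, AEStronglyMeasurable (fun x => F x z) μ := fun z =>
    (hcont.comp (Continuous.prodMk_left z)).aestronglyMeasurable
  have hmeas' : StronglyMeasurable fun x => deriv (F x) z₀ :=
    (stronglyMeasurable_deriv_with_param hcont).comp_measurable measurable_prodMk_right
  refine (hasDerivAt_integral_of_dominated_loc_of_deriv_le (F := fun z x => F x z)
    (F' := fun z x => deriv (F x) z) (bound := fun _ => C / 1)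
    (Metric.ball_mem_nhds z₀ one_pos) (.of_forall hmeas) ?_ hmeas'.aestronglyMeasurable
    (.of_forall fun x z hz => ?_) (integrable_const _)
    (.of_forall fun x z _ => (hd x z).hasDerivAt)).2.differentiableAt
  · exact .of_bound (hmeas z₀) C (.of_forall fun x => hC x z₀ (by linarith))
  · refine Complex.norm_deriv_le_of_forall_mem_sphere_norm_le one_pos (hd x).diffContOnCl
      fun w hw => hC x w ?_
    rw [mem_ball_iff_norm] at hz
    rw [mem_sphere_iff_norm] at hw
    have h1 := norm_add_le (w - z) (z - z₀)
    have h2 := norm_add_le (w - z + (z - z₀)) z₀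
    rw [sub_add_sub_cancel, sub_add_cancel] at h2
    rw [sub_add_sub_cancel] at h1
    linarith

/-- The product of the linear factors `1 + s e^{ix}` and `1 + t e^{-ix}`. -/
noncomputable def phaseProd (a b : Multiset ℂ) (x : ℝ) : ℂ :=
  (a.map fun s => 1 + s * Complex.exp (x * Complex.I)).prod *
    (b.map fun t => 1 + t * Complex.exp (-(x * Complex.I))).prod

theorem continuous_phaseProd (a b : Multiset ℂ) : Continuous (phaseProd a b) := by
  unfold phaseProd
  refine .mul ?_ ?_
  · exact continuous_multiset_prod _ fun s _ => by fun_prop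
  · exact continuous_multiset_prod _ fun s _ => by fun_prop

theorem phaseProd_add (a a' b b' : Multiset ℂ) (x : ℝ) :
    phaseProd (a + a') (b + b') x = phaseProd a b x * phaseProd a' b' x := by
  simp only [phaseProd, Multiset.map_add, Multiset.prod_add]
  ring

theorem integral_exp_pow_mul_exp_neg_pow (k m : ℕ) :
    ∫ x : ℝ in Set.Ioc (-π) π,
      Complex.exp (x * Complex.I) ^ k * Complex.exp (-(x * Complex.I)) ^ m =
        if k = m then 2 * (π : ℂ) else 0 := by
  have h : ∀ x : ℝ, Complex.exp (x * Complex.I) ^ k * Complex.exp (-(x * Complex.I)) ^ m =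
      Complex.exp (((k : ℂ) - m) * Complex.I * x) := by
    intro x
    rw [← Complex.exp_nat_mul, ← Complex.exp_nat_mul, ← Complex.exp_add]
    ring_nf
  simp_rw [h]
  rw [← intervalIntegral.integral_of_le (by linarith [pi_pos])]
  split_ifs with hkm
  · subst hkm
    simp
    ring
  · have hc : ((k : ℂ) - m) * Complex.I ≠ 0 :=
      mul_ne_zero (sub_ne_zero.2 (by exact_mod_cast hkm)) Complex.I_ne_zero
    rw [integral_exp_mul_complex hc, div_eq_zero_iff]
    left
    rw [sub_eq_zero, Complex.exp_eq_exp_iff_exists_int]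
    refine ⟨(k : ℤ) - m, ?_⟩
    push_cast
    ring

open Polynomial in
theorem integral_phaseProd_ne_zero {a b : Multiset ℂ} (ha : ∀ s ∈ a, 0 < s.re)
    (hb : ∀ t ∈ b, 0 < t.re) : ∫ x : ℝ in Set.Ioc (-π) π, phaseProd a b x ≠ 0 := by
  set A : ℂ[X] := (a.map fun s => 1 + C s * X).prod with hA
  set B : ℂ[X] := (b.map fun t => X + C t).prod with hB
  have hAeval : ∀ w, A.eval w = (a.map fun s => 1 + s * w).prod := fun w => by
    rw [hA, eval_multiset_prod, Multiset.map_map]; simp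
  have hBeval : ∀ w, B.eval w = (b.map fun t => w + t).prod := fun w => by
    rw [hB, eval_multiset_prod, Multiset.map_map]; simp
  have hBmonic : B.Monic := monic_multiset_prod_of_monic _ _ fun t _ => monic_X_add_C t
  have hBdeg : B.natDegree = b.card := by
    rw [hB, natDegree_multiset_prod_of_monic]
    · simp
    · intro f hf
      obtain ⟨t, -, rfl⟩ := Multiset.mem_map.1 hf
      exact monic_X_add_C t
  have hA0 : A ≠ 0 := by
    intro h
    have := hAeval 0
    simp [h] at this
  have hdeg : b.card ≤ (A * B).natDegree := by
    rw [mul_comm, hBmonic.natDegree_mul' hA0, hBdeg]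
    omega
  have hroots : ∀ w : ℂ, 0 ≤ w.re → (A * B).eval w ≠ 0 := by
    intro w hw
    rw [eval_mul, hAeval, hBeval]
    refine mul_ne_zero ?_ ?_
    · rw [Ne, Multiset.prod_eq_zero_iff, Multiset.mem_map]
      rintro ⟨s, hs, h⟩
      have hsre := ha s hs
      have hs0 : s ≠ 0 := by rintro rfl; simp at hsre
      have hw' : w = -s⁻¹ := by
        field_simp
        linear_combination h
      rw [hw', Complex.neg_re, Complex.inv_re] at hw
      have := div_pos hsre (Complex.normSq_pos.2 hs0)
      linarith
    · rw [Ne, Multiset.prod_eq_zero_iff, Multiset.mem_map]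
      rintro ⟨t, ht, h⟩
      have := congrArg Complex.re h
      rw [Complex.add_re, Complex.zero_re] at this
      have := hb t ht
      linarith
  have hphase : ∀ x : ℝ, phaseProd a b x = ∑ k ∈ Finset.range ((A * B).natDegree + 1),
      (A * B).coeff k *
        (Complex.exp (x * Complex.I) ^ k * Complex.exp (-(x * Complex.I)) ^ b.card) := by
    intro x
    simp_rw [← mul_assoc]
    rw [← Finset.sum_mul, ← eval_eq_sum_range, eval_mul, hAeval, hBeval, phaseProd, mul_assoc]
    congr 1
    rw [← Multiset.prod_replicate, ← Multiset.map_const', ← Multiset.prod_map_mul]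
    congr 1
    refine Multiset.map_congr rfl fun t _ => ?_
    rw [add_mul, ← Complex.exp_add, add_neg_cancel, Complex.exp_zero]
  simp_rw [hphase]
  rw [integral_finsetSum]
  · simp_rw [integral_const_mul, integral_exp_pow_mul_exp_neg_pow]
    simp only [mul_ite, mul_zero]
    rw [Finset.sum_ite_eq', if_pos (Finset.mem_range.2 (by omega))]
    refine mul_ne_zero (coeff_ne_zero_of_eval_ne_zero hroots hdeg) ?_
    exact mul_ne_zero two_ne_zero (by exact_mod_cast pi_ne_zero)
  · intro k _
    refine Continuous.integrableOn_Ioc ?_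
    fun_prop

/-- The product over `V` of Lebesgue measure on `(-π, π]`. -/
noncomputable abbrev torusMeasure (V : Type*) [Fintype V] : Measure (V → ℝ) :=
  Measure.pi fun _ : V => volume.restrict (Set.Ioc (-π) π)

theorem integrable_torusMeasure {V : Type*} [Fintype V] {g : (V → ℝ) → ℂ} (hg : Continuous g) :
    Integrable g (torusMeasure V) := by
  rw [torusMeasure, ← Measure.restrict_pi_pi]
  have h : IntegrableOn g (Set.univ.pi fun _ : V => Set.Icc (-π) π)
      (Measure.pi fun _ : V => volume) :=
    hg.continuousOn.integrableOn_compact (isCompact_univ_pi fun _ => isCompact_Icc)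
  exact h.mono_set (Set.pi_mono fun _ _ => Set.Ioc_subset_Icc_self)

/-- A weight on configurations whose integral against products of linear factors
`1 + s e^{±iθ_v}` never vanishes when all `Re s > 0`. -/
def IsLeeYangWeight {V : Type*} [Fintype V] (g : (V → ℝ) → ℂ) : Prop :=
  Continuous g ∧ ∀ a b : V → Multiset ℂ, (∀ v, ∀ s ∈ a v, 0 < s.re) →
    (∀ v, ∀ t ∈ b v, 0 < t.re) →
      ∫ θ, g θ * ∏ v, phaseProd (a v) (b v) (θ v) ∂(torusMeasure V) ≠ 0

theorem isLeeYangWeight_one {V : Type*} [Fintype V] :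
    IsLeeYangWeight (fun _ : V → ℝ => (1 : ℂ)) := by
  refine ⟨continuous_const, fun a b ha hb => ?_⟩
  simp_rw [one_mul]
  rw [integral_fintype_prod_eq_prod (fun v => phaseProd (a v) (b v))]
  exact Finset.prod_ne_zero_iff.2 fun v _ => integral_phaseProd_ne_zero (ha v) (hb v)

/-- The regularized ferromagnetic edge factor. -/
noncomputable def edgeFactor (ε κ x y : ℝ) : ℂ :=
  (1 + ε * Complex.exp (x * Complex.I)) * (1 + ε * Complex.exp (-(y * Complex.I))) +
    κ * (Complex.exp (x * Complex.I) * Complex.exp (-(y * Complex.I)))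

theorem continuous_edgeFactor {V : Type*} (ε κ : ℝ) (u v : V) :
    Continuous fun θ : V → ℝ => edgeFactor ε κ (θ u) (θ v) := by
  unfold edgeFactor
  fun_prop

theorem prod_phaseProd_add_single {V : Type*} [Fintype V] [DecidableEq V] (a b : V → Multiset ℂ)
    (u v : V) (s t : ℂ) (θ : V → ℝ) :
    ∏ w, phaseProd ((a + Pi.single u {s} : V → Multiset ℂ) w)
        ((b + Pi.single v {t} : V → Multiset ℂ) w) (θ w) =
      (∏ w, phaseProd (a w) (b w) (θ w)) *
        ((1 + s * Complex.exp (θ u * Complex.I)) * (1 + t * Complex.exp (-(θ v * Complex.I)))) := by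
  simp_rw [Pi.add_apply, phaseProd_add, Finset.prod_mul_distrib]
  congr 1
  simp_rw [phaseProd, Finset.prod_mul_distrib]
  congr 1
  · rw [Finset.prod_eq_single u]
    · simp
    · intro w _ hw; simp [Pi.single_eq_of_ne hw]
    · simp
  · rw [Finset.prod_eq_single v]
    · simp
    · intro w _ hw; simp [Pi.single_eq_of_ne hw]
    · simp

theorem IsLeeYangWeight.mul_edgeFactor {V : Type*} [Fintype V] [DecidableEq V]
    {g : (V → ℝ) → ℂ} (hg : IsLeeYangWeight g) {ε κ : ℝ} (hε : 0 < ε) (hκ : 0 ≤ κ) (u v : V) :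
    IsLeeYangWeight fun θ => g θ * edgeFactor ε κ (θ u) (θ v) := by
  refine ⟨hg.1.mul (continuous_edgeFactor ε κ u v), fun a b ha hb => ?_⟩
  set h : (V → ℝ) → ℂ := fun θ => g θ * ∏ w, phaseProd (a w) (b w) (θ w) with hh
  have hhc : Continuous h := hg.1.mul <| continuous_finsetProd _ fun w _ =>
    (continuous_phaseProd _ _).comp (continuous_apply w)
  set X : (V → ℝ) → ℂ := fun θ => Complex.exp (θ u * Complex.I) with hX
  set Y : (V → ℝ) → ℂ := fun θ => Complex.exp (-(θ v * Complex.I)) with hY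
  have hXc : Continuous X := by rw [hX]; fun_prop
  have hYc : Continuous Y := by rw [hY]; fun_prop
  have i1 : Integrable (fun θ => h θ * ((1 + ε * X θ) * (1 + ε * Y θ))) (torusMeasure V) :=
    integrable_torusMeasure (by fun_prop)
  have i4 : Integrable (fun θ => h θ * (X θ * Y θ)) (torusMeasure V) :=
    integrable_torusMeasure (by fun_prop)
  have key := add_mul_ne_zero_of_biaffine_ne_zero (κ := κ)
    (a := ∫ θ, h θ * ((1 + ε * X θ) * (1 + ε * Y θ)) ∂(torusMeasure V))
    (b := ∫ θ, h θ * (X θ * (1 + ε * Y θ)) ∂(torusMeasure V))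
    (c := ∫ θ, h θ * ((1 + ε * X θ) * Y θ) ∂(torusMeasure V))
    (d := ∫ θ, h θ * (X θ * Y θ) ∂(torusMeasure V)) ?_ hκ
  · rw [← integral_const_mul, ← integral_add i1 (i4.const_mul _)] at key
    convert key using 3 with θ
    simp only [edgeFactor, hh, hX, hY]
    ring
  · intro s t hs ht
    rw [← integral_const_mul, ← integral_const_mul, ← integral_const_mul, ← integral_add,
      ← integral_add, ← integral_add]
    rotate_left
    iterate 6 exact integrable_torusMeasure (by fun_prop)
    have := hg.2 (a + Pi.single u {ε + s}) (b + Pi.single v {ε + t}) ?_ ?_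
    · convert this using 3 with θ
      rw [prod_phaseProd_add_single]
      simp only [hh, hX, hY]
      ring
    all_goals
      intro w r hr
      rw [Pi.add_apply, Multiset.mem_add] at hr
      rcases hr with hr | hr
      · first | exact ha w r hr | exact hb w r hr
      · rw [Pi.single_apply] at hr
        split_ifs at hr with hw
        · rw [Multiset.mem_singleton] at hr
          rw [hr, Complex.add_re, Complex.ofReal_re]
          linarith
        · simp at hr

theorem IsLeeYangWeight.mul_edgeFactor_pow {V : Type*} [Fintype V] [DecidableEq V]
    {g : (V → ℝ) → ℂ} (hg : IsLeeYangWeight g) {ε κ : ℝ} (hε : 0 < ε) (hκ : 0 ≤ κ) (u v : V)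
    (n : ℕ) : IsLeeYangWeight fun θ => g θ * edgeFactor ε κ (θ u) (θ v) ^ n := by
  induction n with
  | zero => simpa using hg
  | succ n ih => simpa only [pow_succ, mul_assoc] using ih.mul_edgeFactor hε hκ u v

theorem norm_one_add_pow_le_exp (g : ℂ) (n : ℕ) : ‖(1 + g) ^ n‖ ≤ Real.exp ‖(n : ℂ) * g‖ := by
  rw [norm_pow, norm_mul, Complex.norm_natCast, Real.exp_nat_mul]
  refine pow_le_pow_left₀ (norm_nonneg _) ?_ n
  have := norm_add_le 1 g
  rw [norm_one] at this
  linarith [Real.add_one_le_exp ‖g‖]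

theorem norm_exp_neg_ofReal_mul_I (x : ℝ) : ‖Complex.exp (-(x * Complex.I))‖ = 1 := by
  rw [← neg_mul, ← Complex.ofReal_neg, Complex.norm_exp_ofReal_mul_I]

theorem edgeFactor_eq_one_add (ε κ x y : ℝ) : edgeFactor ε κ x y =
    1 + (ε * Complex.exp (x * Complex.I) + ε * Complex.exp (-(y * Complex.I)) +
      (ε ^ 2 + κ) * (Complex.exp (x * Complex.I) * Complex.exp (-(y * Complex.I)))) := by
  rw [edgeFactor]
  ring

theorem norm_edgeFactor_pow_le {j : ℝ} (hj : 0 ≤ j) (n : ℕ) (x y : ℝ) :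
    ‖edgeFactor (1 / n ^ 2) (j / (2 * n)) x y ^ n‖ ≤ Real.exp (3 + j) := by
  rw [edgeFactor_eq_one_add]
  refine (norm_one_add_pow_le_exp _ n).trans (Real.exp_le_exp.2 ?_)
  rcases Nat.eq_zero_or_pos n with rfl | hn
  · simp only [Nat.cast_zero, zero_mul, norm_zero]
    positivity
  have hn' : (1 : ℝ) ≤ n := by exact_mod_cast hn
  have hn0 : (n : ℂ) ≠ 0 := by exact_mod_cast hn.ne'
  have heq : (n : ℂ) * (((1 / n ^ 2 : ℝ) : ℂ) * Complex.exp (x * Complex.I) +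
      ((1 / n ^ 2 : ℝ) : ℂ) * Complex.exp (-(y * Complex.I)) +
      (((1 / n ^ 2 : ℝ) : ℂ) ^ 2 + ((j / (2 * n) : ℝ) : ℂ)) *
        (Complex.exp (x * Complex.I) * Complex.exp (-(y * Complex.I)))) =
      ((1 / n : ℝ) : ℂ) * Complex.exp (x * Complex.I) +
      ((1 / n : ℝ) : ℂ) * Complex.exp (-(y * Complex.I)) +
      ((1 / n ^ 3 + j / 2 : ℝ) : ℂ) *
        (Complex.exp (x * Complex.I) * Complex.exp (-(y * Complex.I))) := by
    push_cast
    field_simp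
  rw [heq]
  refine (norm_add₃_le).trans ?_
  simp only [norm_mul, Complex.norm_exp_ofReal_mul_I, norm_exp_neg_ofReal_mul_I, mul_one,
    Complex.norm_real]
  rw [Real.norm_of_nonneg (by positivity), Real.norm_of_nonneg (by positivity)]
  have h1 : 1 / (n : ℝ) ≤ 1 := by rw [div_le_one (by positivity)]; exact hn'
  have h3 : 1 / (n : ℝ) ^ 3 ≤ 1 := by
    rw [div_le_one (by positivity)]; exact one_le_pow₀ hn'
  linarith

theorem tendsto_edgeFactor_pow (j x y : ℝ) :
    Tendsto (fun n : ℕ => edgeFactor (1 / n ^ 2) (j / (2 * n)) x y ^ n) atTop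
      (𝓝 (Complex.exp (j / 2 * (Complex.exp (x * Complex.I) *
        Complex.exp (-(y * Complex.I)))))) := by
  simp_rw [edgeFactor_eq_one_add]
  refine tendsto_one_add_pow_exp tendsto_id ?_
  have h1 : Tendsto (fun n : ℕ => ((n : ℂ))⁻¹) atTop (𝓝 0) := tendsto_inv_atTop_nhds_zero_nat
  have h := ((h1.mul_const (Complex.exp (x * Complex.I))).add
    (h1.mul_const (Complex.exp (-(y * Complex.I))))).add
    (((h1.pow 3).add_const ((j : ℂ) / 2)).mul_const
      (Complex.exp (x * Complex.I) * Complex.exp (-(y * Complex.I))))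
  simp only [zero_mul, zero_add, ne_eq, OfNat.ofNat_ne_zero, not_false_eq_true, zero_pow] at h
  refine h.congr' ?_
  filter_upwards [eventually_ne_atTop 0] with n hn
  have hn0 : (n : ℂ) ≠ 0 := by exact_mod_cast hn
  push_cast
  field_simp

/-- A polynomial approximation of the edge weight `exp (∑ J_e cos (θ_u - θ_v))`. -/
noncomputable def approxEdgeWeight {V : Type*} (E : Finset (Sym2 V)) (J : Sym2 V → ℝ) (n : ℕ)
    (θ : V → ℝ) : ℂ :=
  ∏ e ∈ E, edgeFactor (1 / n ^ 2) (J e / (2 * n)) (θ (Quot.out e).1) (θ (Quot.out e).2) ^ n *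
    edgeFactor (1 / n ^ 2) (J e / (2 * n)) (θ (Quot.out e).2) (θ (Quot.out e).1) ^ n

theorem isLeeYangWeight_approxEdgeWeight {V : Type*} [Fintype V] [DecidableEq V]
    (E : Finset (Sym2 V)) {J : Sym2 V → ℝ} (hJ : ∀ e ∈ E, 0 ≤ J e) {n : ℕ} (hn : 0 < n) :
    IsLeeYangWeight (approxEdgeWeight E J n) := by
  induction E using Finset.induction_on with
  | empty =>
    have : approxEdgeWeight (∅ : Finset (Sym2 V)) J n = fun _ => 1 := by
      funext θ; simp [approxEdgeWeight]
    rw [this]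
    exact isLeeYangWeight_one
  | insert e E he ih =>
    have hJe : 0 ≤ J e / (2 * n) := div_nonneg (hJ e (Finset.mem_insert_self e E)) (by positivity)
    have hε : (0 : ℝ) < 1 / n ^ 2 := by positivity
    have := ((ih fun e' he' => hJ e' (Finset.mem_insert_of_mem he')).mul_edgeFactor_pow hε hJe
      (Quot.out e).1 (Quot.out e).2 n).mul_edgeFactor_pow hε hJe (Quot.out e).2 (Quot.out e).1 n
    convert this using 1
    funext θ
    rw [approxEdgeWeight, Finset.prod_insert he, approxEdgeWeight]
    ring

theorem norm_approxEdgeWeight_le {V : Type*} {E : Finset (Sym2 V)} {J : Sym2 V → ℝ}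
    (hJ : ∀ e ∈ E, 0 ≤ J e) (n : ℕ) (θ : V → ℝ) :
    ‖approxEdgeWeight E J n θ‖ ≤ ∏ e ∈ E, Real.exp (3 + J e) ^ 2 := by
  rw [approxEdgeWeight, norm_prod]
  refine Finset.prod_le_prod (fun _ _ => norm_nonneg _) fun e he => ?_
  rw [norm_mul, sq (Real.exp _)]
  exact mul_le_mul (norm_edgeFactor_pow_le (hJ e he) n _ _) (norm_edgeFactor_pow_le (hJ e he) n _ _)
    (norm_nonneg _) (Real.exp_nonneg _)

theorem xyEdgeCos_eq_cos_out {V : Type*} (θ : V → ℝ) (e : Sym2 V) :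
    xyEdgeCos θ e = Real.cos (θ (Quot.out e).1 - θ (Quot.out e).2) := by
  conv_lhs => rw [← Quot.out_eq e]
  rfl

theorem tendsto_approxEdgeWeight {V : Type*} (E : Finset (Sym2 V)) (J : Sym2 V → ℝ) (θ : V → ℝ) :
    Tendsto (fun n => approxEdgeWeight E J n θ) atTop
      (𝓝 (Complex.exp ((∑ e ∈ E, J e * xyEdgeCos θ e : ℝ) : ℂ))) := by
  rw [Complex.ofReal_sum, Complex.exp_sum]
  refine tendsto_finsetProd _ fun e _ => ?_
  have := (tendsto_edgeFactor_pow (J e) (θ (Quot.out e).1) (θ (Quot.out e).2)).mul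
    (tendsto_edgeFactor_pow (J e) (θ (Quot.out e).2) (θ (Quot.out e).1))
  convert this using 2
  rw [← Complex.exp_add, xyEdgeCos_eq_cos_out, ← Complex.exp_add, ← Complex.exp_add]
  push_cast
  rw [Complex.cos]
  congr 1
  ring_nf

/-- A polynomial approximation of the field weight `exp (∑ 2 ζ_v cos θ_v)`. -/
noncomputable def approxFieldWeight {V : Type*} [Fintype V] (ζ : V → ℂ) (n : ℕ) (θ : V → ℝ) : ℂ :=
  ∏ v, phaseProd (Multiset.replicate n ((ζ v + 1 / n) / n))
    (Multiset.replicate n ((ζ v + 1 / n) / n)) (θ v)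

theorem phaseProd_replicate (n : ℕ) (s : ℂ) (x : ℝ) :
    phaseProd (Multiset.replicate n s) (Multiset.replicate n s) x =
      (1 + s * Complex.exp (x * Complex.I)) ^ n * (1 + s * Complex.exp (-(x * Complex.I))) ^ n := by
  simp [phaseProd]

theorem norm_approxFieldWeight_le {V : Type*} [Fintype V] {ζ : V → ℂ} {K : V → ℝ}
    (hK : ∀ v, ‖ζ v‖ ≤ K v) (n : ℕ) (θ : V → ℝ) :
    ‖approxFieldWeight ζ n θ‖ ≤ ∏ v, Real.exp (K v + 1) ^ 2 := by
  rw [approxFieldWeight, norm_prod]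
  refine Finset.prod_le_prod (fun _ _ => norm_nonneg _) fun v _ => ?_
  have key : ∀ u : ℂ, ‖u‖ = 1 →
      ‖(1 + (ζ v + 1 / n) / n * u) ^ n‖ ≤ Real.exp (K v + 1) := by
    intro u hu
    refine (norm_one_add_pow_le_exp _ n).trans (Real.exp_le_exp.2 ?_)
    have hKv := (norm_nonneg _).trans (hK v)
    rcases Nat.eq_zero_or_pos n with rfl | hn
    · simp only [Nat.cast_zero, zero_mul, norm_zero]
      linarith
    have hn' : (1 : ℝ) ≤ n := by exact_mod_cast hn
    have hn0 : (n : ℂ) ≠ 0 := by exact_mod_cast hn.ne'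
    rw [← mul_assoc, mul_div_cancel₀ _ hn0, norm_mul, hu, mul_one]
    refine (norm_add_le _ _).trans (add_le_add (hK v) ?_)
    rw [norm_div, norm_one, Complex.norm_natCast, div_le_one (by positivity)]
    exact hn'
  rw [phaseProd_replicate, norm_mul, sq]
  exact mul_le_mul (key _ (Complex.norm_exp_ofReal_mul_I _)) (key _ (norm_exp_neg_ofReal_mul_I _))
    (norm_nonneg _) (Real.exp_nonneg _)

theorem tendsto_approxFieldWeight {V ι : Type*} [Fintype V] {l : Filter ι} {N : ι → ℕ}
    (hN : Tendsto N l atTop) {ζ : ι → V → ℂ} {ζ₀ : V → ℂ}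
    (hζ : ∀ v, Tendsto (fun i => ζ i v) l (𝓝 (ζ₀ v))) (θ : V → ℝ) :
    Tendsto (fun i => approxFieldWeight (ζ i) (N i) θ) l
      (𝓝 (Complex.exp (∑ v, 2 * ζ₀ v * (Real.cos (θ v) : ℂ)))) := by
  rw [Complex.exp_sum]
  refine tendsto_finsetProd _ fun v _ => ?_
  have key : ∀ u : ℂ, Tendsto (fun i => (1 + (ζ i v + 1 / N i) / N i * u) ^ N i) l
      (𝓝 (Complex.exp (ζ₀ v * u))) := by
    intro u
    refine tendsto_one_add_pow_exp hN ?_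
    have h1 : Tendsto (fun i => ((N i : ℂ))⁻¹) l (𝓝 0) :=
      (tendsto_inv_atTop_nhds_zero_nat (𝕜 := ℂ)).comp hN
    have h := ((hζ v).add h1).mul_const u
    rw [add_zero] at h
    refine h.congr' ?_
    filter_upwards [hN.eventually_ne_atTop 0] with i hi
    have hn0 : (N i : ℂ) ≠ 0 := by exact_mod_cast hi
    rw [← mul_assoc, mul_div_cancel₀ _ hn0, one_div]
  simp_rw [phaseProd_replicate]
  have := (key (Complex.exp (θ v * Complex.I))).mul (key (Complex.exp (-(θ v * Complex.I))))
  convert this using 2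
  rw [← Complex.exp_add, Complex.ofReal_cos, Complex.cos]
  congr 1
  ring_nf

theorem integral_mul_approxFieldWeight_ne_zero {V : Type*} [Fintype V] [DecidableEq V]
    {g : (V → ℝ) → ℂ} (hg : IsLeeYangWeight g) {ζ : V → ℂ} (hζ : ∀ v, 0 ≤ (ζ v).re) {n : ℕ}
    (hn : 0 < n) : ∫ θ, g θ * approxFieldWeight ζ n θ ∂(torusMeasure V) ≠ 0 := by
  have hre : ∀ v, 0 < ((ζ v + 1 / n) / n).re := by
    intro v
    have h : ((ζ v + 1 / n) / n).re = ((ζ v).re + 1 / n) / n := by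
      rw [Complex.div_natCast_re, Complex.add_re, Complex.div_natCast_re, Complex.one_re]
    rw [h]
    have := hζ v
    positivity
  refine hg.2 _ _ ?_ ?_ <;>
  · intro v s hs
    rw [Multiset.eq_of_mem_replicate hs]
    exact hre v

theorem continuous_approxFieldWeight {V : Type*} [Fintype V] {ζ : ℂ → V → ℂ}
    (hζ : ∀ v, Continuous fun τ => ζ τ v) (n : ℕ) :
    Continuous fun p : (V → ℝ) × ℂ => approxFieldWeight (ζ p.2) n p.1 := by
  simp_rw [approxFieldWeight, phaseProd_replicate]
  refine continuous_finsetProd _ fun v _ => ?_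
  have := (hζ v).comp (continuous_snd (X := V → ℝ))
  simp only [Function.comp_def] at this
  fun_prop

theorem differentiable_approxFieldWeight {V : Type*} [Fintype V] {ζ : ℂ → V → ℂ}
    (hζ : ∀ v, Differentiable ℂ fun τ => ζ τ v) (n : ℕ) (θ : V → ℝ) :
    Differentiable ℂ fun τ => approxFieldWeight (ζ τ) n θ := by
  simp_rw [approxFieldWeight, phaseProd_replicate]
  refine Differentiable.fun_finsetProd fun v _ => ?_
  have := hζ v
  fun_prop

theorem integral_exp_ofReal_ne_zero {V : Type*} [Fintype V] {h : (V → ℝ) → ℝ}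
    (hh : Continuous h) : ∫ θ, Complex.exp (h θ : ℂ) ∂(torusMeasure V) ≠ 0 := by
  simp_rw [← Complex.ofReal_exp]
  rw [integral_complex_ofReal, Complex.ofReal_ne_zero]
  have hint : Integrable (fun θ => Real.exp (h θ)) (torusMeasure V) := by
    have hc : Continuous fun θ => ((Real.exp (h θ) : ℝ) : ℂ) := by fun_prop
    simpa only [RCLike.re_eq_complex_re, Complex.ofReal_re] using (integrable_torusMeasure hc).re
  have hne : NeZero (torusMeasure V) := by
    refine ⟨fun h0 => ?_⟩
    have := congrArg (fun m : Measure (V → ℝ) => m Set.univ) h0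
    simp [torusMeasure, Measure.pi_univ] at this
    linarith [Real.pi_pos]
  exact (integral_exp_pos hint).ne'

/-- Multivariable Lee–Yang theorem for the XY model: on a finite graph `(V, E)` with
ferromagnetic couplings `J_e ≥ 0` and nonnegative weights `λ_v ≥ 0`, the multivariate
moment generating function does not vanish when all `Re z_v > 0`. -/
theorem xy_model_lee_yang_multivariable {V : Type*} [Fintype V] [DecidableEq V]
    (E : Finset (Sym2 V)) (hE : ∀ e ∈ E, ¬ e.IsDiag)
    (J : Sym2 V → ℝ) (hJ : ∀ e ∈ E, 0 ≤ J e)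
    (lam : V → ℝ) (hlam : ∀ v, 0 ≤ lam v)
    (z : V → ℂ) (hz : ∀ v, 0 < (z v).re) :
    (∫ θ : V → ℝ,
        Complex.exp ((∑ e ∈ E, J e * xyEdgeCos θ e : ℝ) : ℂ) *
          Complex.exp (∑ v, z v * ((lam v * Real.cos (θ v) : ℝ) : ℂ))
        ∂(Measure.pi fun _ : V => volume.restrict (Set.Ioc (-π) π))) ≠ 0 := by
  -- the segment from the constant field `1` to `z`
  set ζ : ℂ → V → ℂ := fun τ v => lam v / 2 * (1 + τ * (z v - 1)) with hζ
  set f : ℂ → ℂ := fun τ => ∫ θ : V → ℝ,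
    Complex.exp ((∑ e ∈ E, J e * xyEdgeCos θ e : ℝ) : ℂ) *
      Complex.exp (∑ v, 2 * ζ τ v * (Real.cos (θ v) : ℂ)) ∂(torusMeasure V) with hf
  set F : ℕ → ℂ → ℂ := fun n τ =>
    ∫ θ, approxEdgeWeight E J (n + 1) θ * approxFieldWeight (ζ τ) (n + 1) θ ∂(torusMeasure V)
    with hF
  set U : Set ℂ := ⋂ v, {τ : ℂ | 0 < (1 + τ * (z v - 1)).re} with hU
  have hUopen : IsOpen U := isOpen_iInter_of_finite fun v =>
    isOpen_lt continuous_const (by fun_prop)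
  have hUconv : Convex ℝ U := convex_iInter fun v => by
    intro x hx y hy p q hp hq hpq
    simp only [Set.mem_ofPred_eq] at hx hy ⊢
    have h : (1 + (p • x + q • y) * (z v - 1)).re =
        p * (1 + x * (z v - 1)).re + q * (1 + y * (z v - 1)).re := by
      rw [← Complex.re_ofReal_mul, ← Complex.re_ofReal_mul, ← Complex.add_re]
      congr 1
      have : (p : ℂ) + q = 1 := by exact_mod_cast hpq
      simp only [Complex.real_smul]
      linear_combination -this
    rw [h]
    rcases hp.eq_or_lt with rfl | hp'
    · have : q = 1 := by linarith
      subst this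
      linarith
    · exact add_pos_of_pos_of_nonneg (mul_pos hp' hx) (mul_nonneg hq hy.le)
  have h0U : (0 : ℂ) ∈ U := by simp [hU]
  have h1U : (1 : ℂ) ∈ U := by simpa [hU] using hz
  have hζd : ∀ v, Differentiable ℂ fun τ => ζ τ v := fun v => by
    simp only [hζ]; fun_prop
  have hcos : Continuous fun θ : V → ℝ => ∑ e ∈ E, J e * xyEdgeCos θ e := by
    simp_rw [xyEdgeCos_eq_cos_out]
    fun_prop
  have hbound : ∀ R : ℝ, ∃ C : ℝ, ∀ (n : ℕ) (θ : V → ℝ) (τ : ℂ), ‖τ‖ ≤ R →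
      ‖approxEdgeWeight E J (n + 1) θ * approxFieldWeight (ζ τ) (n + 1) θ‖ ≤ C := by
    intro R
    refine ⟨(∏ e ∈ E, Real.exp (3 + J e) ^ 2) *
      ∏ v, Real.exp (‖(lam v / 2 : ℂ)‖ * (1 + R * ‖z v - 1‖) + 1) ^ 2, fun n θ τ hτ => ?_⟩
    rw [norm_mul]
    refine mul_le_mul (norm_approxEdgeWeight_le hJ _ _)
      (norm_approxFieldWeight_le (fun v => ?_) _ _) (norm_nonneg _) (by positivity)
    simp only [hζ]
    rw [norm_mul]
    refine mul_le_mul_of_nonneg_left ((norm_add_le _ _).trans ?_) (norm_nonneg _)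
    rw [norm_one, norm_mul]
    gcongr
  have hweight : ∀ n : ℕ, IsLeeYangWeight (approxEdgeWeight E J (n + 1)) := fun n =>
    isLeeYangWeight_approxEdgeWeight E hJ n.succ_pos
  have hcont : ∀ n : ℕ, Continuous fun p : (V → ℝ) × ℂ =>
      approxEdgeWeight E J (n + 1) p.1 * approxFieldWeight (ζ p.2) (n + 1) p.1 := fun n =>
    ((hweight n).1.comp continuous_fst).mul
      (continuous_approxFieldWeight (fun v => (hζd v).continuous) _)
  have hFd : ∀ n, Differentiable ℂ (F n) := by
    intro n
    refine differentiable_integral_of_locally_bounded (hcont n) (fun θ => ?_) fun R => ?_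
    · exact (differentiable_approxFieldWeight hζd _ θ).const_mul _
    · obtain ⟨C, hC⟩ := hbound R
      exact ⟨C, fun θ τ => hC n θ τ⟩
  have hFne : ∀ n, ∀ τ ∈ U, F n τ ≠ 0 := by
    intro n τ hτ
    refine integral_mul_approxFieldWeight_ne_zero (hweight n) (fun v => ?_) n.succ_pos
    have h1 : 0 < (1 + τ * (z v - 1)).re := Set.mem_iInter.1 hτ v
    have h2 : ζ τ v = ((lam v / 2 : ℝ) : ℂ) * (1 + τ * (z v - 1)) := by
      simp only [hζ]; push_cast; rfl
    rw [h2, Complex.re_ofReal_mul]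
    exact mul_nonneg (by linarith [hlam v]) h1.le
  have hlim : TendstoLocallyUniformlyOn F f atTop U := by
    refine tendstoLocallyUniformlyOn_of_forall_tendsto_prod fun τ _ => ?_
    obtain ⟨C, hC⟩ := hbound (‖τ‖ + 1)
    have hN : Tendsto (fun p : ℕ × ℂ => p.1 + 1) (atTop ×ˢ 𝓝 τ) atTop :=
      (tendsto_add_atTop_nat 1).comp tendsto_fst
    refine tendsto_integral_filter_of_dominated_convergence (fun _ => C) ?_ ?_
      (integrable_const _) ?_
    · exact .of_forall fun p => ((hcont p.1).comp (Continuous.prodMk_left p.2)).aestronglyMeasurable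
    · filter_upwards [tendsto_snd.eventually (Metric.ball_mem_nhds τ one_pos)] with p hp
      refine .of_forall fun θ => hC p.1 θ p.2 ?_
      rw [dist_eq_norm] at hp
      have := norm_add_le (p.2 - τ) τ
      rw [sub_add_cancel] at this
      linarith
    · refine .of_forall fun θ => ?_
      exact ((tendsto_approxEdgeWeight E J θ).comp hN).mul
        (tendsto_approxFieldWeight hN
          (fun v => ((hζd v).continuous.tendsto τ).comp tendsto_snd) θ)
  have hf0 : f 0 ≠ 0 := by
    have := integral_exp_ofReal_ne_zero (V := V)
      (h := fun θ => ∑ e ∈ E, J e * xyEdgeCos θ e + ∑ v, lam v * Real.cos (θ v))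
      (hcos.add (by fun_prop))
    convert this using 3 with θ
    rw [← Complex.exp_add, Complex.ofReal_add]
    congr 2
    push_cast
    refine Finset.sum_congr rfl fun v _ => ?_
    simp only [hζ]
    ring
  have hf1 := ne_zero_of_tendstoLocallyUniformlyOn hUopen hUconv.isPreconnected
    (fun n => (hFd n).differentiableOn) (.of_forall hFne) hlim h0U hf0 h1U
  convert hf1 using 3 with θ
  refine congrArg (fun w => Complex.exp _ * Complex.exp w) ?_
  refine Finset.sum_congr rfl fun v _ => ?_
  simp only [hζ]
  push_cast
  ring
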